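/- Let n ≥ 2 and let J be the two-sided ideal of ℤ⟨x,y⟩ generated by the elements r_{1,n} = xⁿ − 1, s_0 = y² − y, and s_j = y x^j y for 1 ≤ j ≤ n−1 (note r_{2,n} is NOT among the generators). Then the quotient ring ℤ⟨x,y⟩ / J is isomorphic to the direct product of rings M_n(ℤ) × ℤ[t]/(tⁿ − 1). -/

import Mathlib

/-- The `n × n` cyclic permutation matrix `X = E₂₁ + E₃₂ + ⋯ + E_{n,n-1} + E_{1n}`,
with `X i j = 1` iff `i ≡ j + 1 (mod n)`. -/
def Xmat (n : ℕ) : Matrix (Fin n) (Fin n) ℤ :=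
  Matrix.of fun i j => if (i : ℕ) = ((j : ℕ) + 1) % n then 1 else 0

/-- The matrix unit `Y = E₁₁`. -/
def Ymat (n : ℕ) : Matrix (Fin n) (Fin n) ℤ :=
  Matrix.of fun i j => if (i : ℕ) = 0 ∧ (j : ℕ) = 0 then 1 else 0

/-- The generator `x` of the free ring `ℤ⟨x,y⟩ = FreeAlgebra ℤ (Fin 2)`. -/
noncomputable def fx : FreeAlgebra ℤ (Fin 2) := FreeAlgebra.ι ℤ 0

/-- The generator `y` of the free ring `ℤ⟨x,y⟩ = FreeAlgebra ℤ (Fin 2)`. -/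
noncomputable def fy : FreeAlgebra ℤ (Fin 2) := FreeAlgebra.ι ℤ 1

/-- The ring homomorphism `φₙ : ℤ⟨x,y⟩ → Mₙ(ℤ)` sending `x ↦ X`, `y ↦ Y`. -/
noncomputable def phi (n : ℕ) : FreeAlgebra ℤ (Fin 2) →ₐ[ℤ] Matrix (Fin n) (Fin n) ℤ :=
  FreeAlgebra.lift ℤ ![Xmat n, Ymat n]

/-- `r_{1,n} = xⁿ - 1`. -/
noncomputable def r1 (n : ℕ) : FreeAlgebra ℤ (Fin 2) := fx ^ n - 1

/-- `r_{2,n} = (Σ_{i=0}^{n-1} x^{n-i} y x^i) - 1`. -/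
noncomputable def r2 (n : ℕ) : FreeAlgebra ℤ (Fin 2) :=
  (∑ i ∈ Finset.range n, fx ^ (n - i) * fy * fx ^ i) - 1

/-- `s₀ = y² - y`. -/
noncomputable def s0 : FreeAlgebra ℤ (Fin 2) := fy ^ 2 - fy

/-- `s_j = y x^j y`. -/
noncomputable def s (j : ℕ) : FreeAlgebra ℤ (Fin 2) := fy * fx ^ j * fy

section MatrixUnits

variable {ι R : Type*} [Fintype ι] [DecidableEq ι] [Ring R]

/-- The non-unital ring homomorphism from integer matrices determined by a family of
matrix units. -/
def matrixUnitsHom (e : ι → ι → R)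
    (he : ∀ i j k l, e i j * e k l = if j = k then e i l else 0) :
    Matrix ι ι ℤ →ₙ+* R where
  toFun M := ∑ i, ∑ j, M i j • e i j
  map_zero' := by simp
  map_add' M N := by simp [add_smul, Finset.sum_add_distrib]
  map_mul' M N := by
    simp only [Matrix.mul_apply, Finset.sum_smul, Finset.sum_mul]
    refine Finset.sum_congr rfl fun i _ => ?_
    rw [Finset.sum_comm]
    refine Finset.sum_congr rfl fun j _ => ?_
    simp only [Finset.mul_sum, smul_mul_smul_comm, he]
    rw [Finset.sum_comm]
    simp

theorem matrixUnitsHom_apply (e : ι → ι → R)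
    (he : ∀ i j k l, e i j * e k l = if j = k then e i l else 0) (M : Matrix ι ι ℤ) :
    matrixUnitsHom e he M = ∑ i, ∑ j, M i j • e i j := rfl

end MatrixUnits

/-- A non-unital ring homomorphism `f` on a unital ring `A` and a ring homomorphism `g` on `B`
whose values commute with the idempotent `f 1` glue to a ring homomorphism on `A × B`. -/
def prodGlueHom {A B R : Type*} [Ring A] [Ring B] [Ring R] (f : A →ₙ+* R) (g : B →+* R)
    (h : ∀ b, Commute (f 1) (g b)) : A × B →+* R where
  toFun p := f p.1 + (1 - f 1) * g p.2
  map_one' := by simp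
  map_zero' := by simp
  map_add' p q := by simp only [Prod.fst_add, Prod.snd_add, map_add]; noncomm_ring
  map_mul' p q := by
    have h₁ : f p.1 * (1 - f 1) = 0 := by rw [mul_sub, ← map_mul]; simp
    have h₂ : (1 - f 1) * f q.1 = 0 := by rw [sub_mul, ← map_mul]; simp
    have h₃ : (1 - f 1) * (1 - f 1) = 1 - f 1 := by
      rw [mul_sub, sub_mul 1 (f 1) (f 1), ← map_mul]; simp
    have h₄ : ∀ b, g b * (1 - f 1) = (1 - f 1) * g b := fun b =>
      ((Commute.one_left _).sub_left (h b)).eq.symm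
    simp only [Prod.fst_mul, Prod.snd_mul, map_mul, add_mul, mul_add]
    have h₅ : (1 - f 1) * g p.2 * f q.1 = 0 := by rw [← h₄, mul_assoc, h₂, mul_zero]
    have h₆ : (1 - f 1) * g p.2 * ((1 - f 1) * g q.2) = (1 - f 1) * (g p.2 * g q.2) := by
      rw [← mul_assoc, mul_assoc _ (g p.2), h₄, ← mul_assoc, h₃, mul_assoc]
    rw [← mul_assoc (f p.1), h₁, h₅, h₆, zero_mul, add_zero, zero_add]

section CyclicMatrixUnits

variable {R : Type*} [Ring R] {n : ℕ} {x y : R}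

/-- The elements `xⁱ y xⁿ⁻ʲ`, which are matrix units under the relations `xⁿ = 1`, `y² = y` and
`y xʲ y = 0` for `0 < j < n`. -/
def cyclicUnit (n : ℕ) (x y : R) (i j : Fin n) : R := x ^ (i : ℕ) * y * x ^ (n - j)

theorem mul_pow_mul_eq_ite (hx : x ^ n = 1) (hy : y ^ 2 = y)
    (hxy : ∀ j, 1 ≤ j → j ≤ n - 1 → y * x ^ j * y = 0) (k : ℕ) (hk : k < 2 * n) :
    y * x ^ k * y = if k = 0 ∨ k = n then y else 0 := by
  rcases Nat.eq_zero_or_pos k with rfl | h0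
  · simpa [sq] using hy
  rcases lt_trichotomy k n with h | rfl | h
  · rw [hxy k h0 (by omega), if_neg (by omega)]
  · simpa [sq, hx] using hy
  · obtain ⟨m, rfl⟩ := Nat.exists_eq_add_of_lt h
    rw [add_assoc, pow_add, hx, one_mul, hxy _ (by omega) (by omega), if_neg (by omega)]

theorem cyclicUnit_mul_cyclicUnit (hx : x ^ n = 1) (hy : y ^ 2 = y)
    (hxy : ∀ j, 1 ≤ j → j ≤ n - 1 → y * x ^ j * y = 0) (i j k l : Fin n) :
    cyclicUnit n x y i j * cyclicUnit n x y k l =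
      if j = k then cyclicUnit n x y i l else 0 := by
  have h := mul_pow_mul_eq_ite hx hy hxy (n - j + k) (by omega)
  have h' : cyclicUnit n x y i j * cyclicUnit n x y k l =
      x ^ (i : ℕ) * (y * x ^ (n - j + k : ℕ) * y) * x ^ (n - l : ℕ) := by
    simp only [cyclicUnit, pow_add, mul_assoc]
  rw [h', h]
  by_cases hjk : j = k
  · subst hjk
    rw [if_pos (by omega), if_pos rfl, cyclicUnit]
  · rw [if_neg (by omega), if_neg hjk, mul_zero, zero_mul]

theorem commute_sum_cyclicUnit (hx : x ^ n = 1) : Commute (∑ i, cyclicUnit n x y i i) x := by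
  have h : ∑ i, cyclicUnit n x y i i = ∑ i ∈ Finset.range n, x ^ i * y * x ^ (n - i) :=
    Fin.sum_univ_eq_sum_range (fun i => x ^ i * y * x ^ (n - i)) n
  rw [h, Commute, SemiconjBy, Finset.sum_mul, Finset.mul_sum]
  have h₁ := Finset.sum_range_succ (fun i => x ^ i * y * x ^ (n + 1 - i)) n
  have h₂ := Finset.sum_range_succ' (fun i => x ^ i * y * x ^ (n + 1 - i)) n
  simp only [Nat.add_sub_add_right, Nat.add_sub_cancel_left, hx, pow_one, pow_zero, one_mul,
    Nat.sub_zero, pow_succ x n] at h₁ h₂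
  rw [h₁, add_left_inj] at h₂
  convert h₂ using 1
  · refine Finset.sum_congr rfl fun i hi => ?_
    rw [mul_assoc, ← pow_succ, Nat.succ_sub (Finset.mem_range.1 hi).le]
  · simp only [pow_succ', mul_assoc]

end CyclicMatrixUnits

theorem Xmat_pow_apply (n k : ℕ) (i j : Fin n) :
    (Xmat n ^ k) i j = if (i : ℕ) = (j + k) % n then 1 else 0 := by
  have hn : 0 < n := i.pos
  induction k generalizing j with
  | zero =>
    simp [Matrix.one_apply, Nat.mod_eq_of_lt j.isLt, Fin.ext_iff]
  | succ k ih =>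
    rw [pow_succ, Matrix.mul_apply,
      Finset.sum_eq_single (⟨(j + 1) % n, Nat.mod_lt _ hn⟩ : Fin n)]
    · rw [ih]
      simp [Xmat, add_assoc, add_comm 1 k]
    · intro l _ hl
      rw [Xmat, Matrix.of_apply, if_neg (by simpa [Fin.ext_iff] using hl), mul_zero]
    · simp

theorem Xmat_pow_card (n : ℕ) : Xmat n ^ n = 1 := by
  ext i j
  simp [Xmat_pow_apply, Matrix.one_apply, Nat.mod_eq_of_lt j.isLt, Fin.ext_iff]

theorem Ymat_eq_single {n : ℕ} (hn : 0 < n) :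
    Ymat n = Matrix.single ⟨0, hn⟩ ⟨0, hn⟩ 1 := by
  ext i j
  simp [Ymat, Matrix.single_apply, Fin.ext_iff, eq_comm]

theorem Ymat_sq (n : ℕ) : Ymat n ^ 2 = Ymat n := by
  rcases Nat.eq_zero_or_pos n with rfl | hn
  · exact Subsingleton.elim _ _
  · simp [Ymat_eq_single hn, sq]

theorem Ymat_mul_Xmat_pow_mul_Ymat {n j : ℕ} (h₁ : 1 ≤ j) (h₂ : j ≤ n - 1) :
    Ymat n * Xmat n ^ j * Ymat n = 0 := by
  have hn : 0 < n := by omega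
  have hj : j < n := by omega
  rw [Ymat_eq_single hn, Matrix.single_mul_mul_single, Xmat_pow_apply]
  simp [Nat.mod_eq_of_lt hj, show 0 ≠ j by omega]

theorem cyclicUnit_Xmat_Ymat {n : ℕ} (i j : Fin n) :
    cyclicUnit n (Xmat n) (Ymat n) i j = Matrix.single i j 1 := by
  have hn : 0 < n := i.pos
  ext a b
  have hb : 0 = ((b : ℕ) + (n - j)) % n ↔ j = b := by
    rw [Fin.ext_iff]
    rcases lt_or_ge (b : ℕ) j with h | h
    · rw [Nat.mod_eq_of_lt (by omega)]; omega
    · rw [show (b : ℕ) + (n - j) = b - j + n by omega, Nat.add_mod_right,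
        Nat.mod_eq_of_lt (by omega)]
      omega
  rw [cyclicUnit, Ymat_eq_single hn, Matrix.mul_apply, Finset.sum_eq_single ⟨0, hn⟩]
  · rw [Matrix.mul_single_apply_same, Xmat_pow_apply, Xmat_pow_apply, Matrix.single_apply]
    simp only [hb, zero_add, Nat.mod_eq_of_lt i.isLt, ← Fin.ext_iff, eq_comm (a := a)]
    split_ifs <;> simp_all
  · intro c _ hc
    rw [Matrix.mul_single_apply_of_ne _ _ _ _ _ hc, zero_mul]
  · simp

/-- The generator of `ℤ[t]/(tⁿ - 1)`. -/
noncomputable def cyclicGen (n : ℕ) :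
    Polynomial ℤ ⧸ Ideal.span {(Polynomial.X : Polynomial ℤ) ^ n - 1} :=
  Ideal.Quotient.mk _ Polynomial.X

theorem cyclicGen_pow (n : ℕ) : cyclicGen n ^ n = 1 := by
  rw [cyclicGen, ← map_pow, ← map_one (Ideal.Quotient.mk _), Ideal.Quotient.mk_eq_mk_iff_sub_mem]
  exact Ideal.subset_span rfl

/-- The ring homomorphism `ℤ[t]/(tⁿ - 1) → R` sending `t` to an element `x` with `xⁿ = 1`. -/
noncomputable def cyclicLift {R : Type*} [Ring R] {n : ℕ} {x : R} (hx : x ^ n = 1) :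
    (Polynomial ℤ ⧸ Ideal.span {(Polynomial.X : Polynomial ℤ) ^ n - 1}) →+* R :=
  Ideal.Quotient.lift _ (Polynomial.aeval x : Polynomial ℤ →ₐ[ℤ] R).toRingHom fun a ha => by
    obtain ⟨b, rfl⟩ := Ideal.mem_span_singleton'.1 ha
    simp [hx]

@[simp]
theorem cyclicLift_gen {R : Type*} [Ring R] {n : ℕ} {x : R} (hx : x ^ n = 1) :
    cyclicLift hx (cyclicGen n) = x := by
  simp [cyclicLift, cyclicGen]

theorem commute_cyclicLift {R : Type*} [Ring R] {n : ℕ} {x a : R} (hx : x ^ n = 1)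
    (h : Commute a x) (c) : Commute a (cyclicLift hx c) := by
  obtain ⟨p, rfl⟩ := Ideal.Quotient.mk_surjective c
  change Commute a (Polynomial.aeval x p)
  induction p using Polynomial.induction_on' with
  | add p q hp hq => rw [map_add]; exact hp.add_right hq
  | monomial k m =>
    rw [Polynomial.aeval_monomial]
    exact (Int.cast_commute m a).symm.mul_right (h.pow_right k)

theorem cyclicQuotient_ringHom_ext {n : ℕ} {S : Type*} [Ring S]
    {f g : (Polynomial ℤ ⧸ Ideal.span {(Polynomial.X : Polynomial ℤ) ^ n - 1}) →+* S}
    (h : f (cyclicGen n) = g (cyclicGen n)) : f = g :=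
  Ideal.Quotient.ringHom_ext <| Polynomial.ringHom_ext (fun a => by simp) h

theorem freeAlgebra_ringHom_ext {ι S : Type*} [Ring S] {f g : FreeAlgebra ℤ ι →+* S}
    (h : ∀ i, f (FreeAlgebra.ι ℤ i) = g (FreeAlgebra.ι ℤ i)) : f = g := by
  have h' : f.toIntAlgHom = g.toIntAlgHom := FreeAlgebra.hom_ext (funext h)
  exact RingHom.ext fun a => DFunLike.congr_fun h' a

theorem stmt_16 (n : ℕ) (hn : 2 ≤ n) :
    Nonempty
      ((TwoSidedIdeal.span
          ({r1 n, s0} ∪ { a | ∃ j, 1 ≤ j ∧ j ≤ n - 1 ∧ a = s j })).ringCon.Quotient ≃+*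
        (Matrix (Fin n) (Fin n) ℤ ×
          (Polynomial ℤ ⧸ Ideal.span {(Polynomial.X : Polynomial ℤ) ^ n - 1}))) := by
  have hn₀ : 0 < n := by omega
  set G : Set (FreeAlgebra ℤ (Fin 2)) :=
    {r1 n, s0} ∪ { a | ∃ j, 1 ≤ j ∧ j ≤ n - 1 ∧ a = s j } with hG
  set c := (TwoSidedIdeal.span G).ringCon
  set x : c.Quotient := c.mk' fx
  set y : c.Quotient := c.mk' fy
  have hker : ∀ a ∈ G, c.mk' a = 0 := fun a ha =>
    (RingCon.eq c).2 ((TwoSidedIdeal.mem_iff _ _).1 (TwoSidedIdeal.subset_span ha))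
  have hx : x ^ n = 1 := by
    have h := hker (r1 n) (by simp [hG])
    rwa [r1, map_sub, map_pow, map_one, sub_eq_zero] at h
  have hy : y ^ 2 = y := by
    have h := hker s0 (by simp [hG])
    rwa [s0, map_sub, map_pow, sub_eq_zero] at h
  have hxy : ∀ j, 1 ≤ j → j ≤ n - 1 → y * x ^ j * y = 0 := fun j h₁ h₂ => by
    have h := hker (s j) (Or.inr ⟨j, h₁, h₂, rfl⟩)
    rwa [s, map_mul, map_mul, map_pow] at h
  let F₀ := FreeAlgebra.lift ℤ 
    (![(Xmat n, cyclicGen n), (Ymat n, 0)] : Fin 2 → Matrix (Fin n) (Fin n) ℤ ×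
      (Polynomial ℤ ⧸ Ideal.span {(Polynomial.X : Polynomial ℤ) ^ n - 1}))
  have hF₀x : F₀ fx = (Xmat n, cyclicGen n) := by simp [F₀, fx]
  have hF₀y : F₀ fy = (Ymat n, 0) := by simp [F₀, fy]
  have hGF : G ⊆ (TwoSidedIdeal.ker F₀.toRingHom : Set _) := by
    rintro a ((rfl | rfl) | ⟨j, h₁, h₂, rfl⟩) <;>
      refine (TwoSidedIdeal.mem_ker _).2 (show F₀ _ = 0 from ?_)
    · simp [r1, hF₀x, Xmat_pow_card, cyclicGen_pow, Prod.mk_one_one]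
    · simp [s0, hF₀y, Ymat_sq]
    · simp [s, hF₀x, hF₀y, Ymat_mul_Xmat_pow_mul_Ymat h₁ h₂]
  let F := c.lift F₀.toRingHom
    (TwoSidedIdeal.ringCon_le_iff.1 (TwoSidedIdeal.span_le.2 hGF))
  have hFx : F x = (Xmat n, cyclicGen n) := hF₀x
  have hFy : F y = (Ymat n, 0) := hF₀y
  let e := matrixUnitsHom (cyclicUnit n x y) (cyclicUnit_mul_cyclicUnit hx hy hxy)
  have he1 : e 1 = ∑ i, cyclicUnit n x y i i := by
    simp [e, matrixUnitsHom_apply, Matrix.one_apply, ite_smul]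
  have hcomm : Commute (e 1) x := he1 ▸ commute_sum_cyclicUnit hx
  let H := prodGlueHom e (cyclicLift hx) (commute_cyclicLift hx hcomm)
  have hFe : ∀ M, F (e M) = (M, 0) := fun M => by
    have h : ∀ i j, F (cyclicUnit n x y i j) = (Matrix.single i j 1, 0) := fun i j => by
      rw [← cyclicUnit_Xmat_Ymat]
      simp only [cyclicUnit, map_mul, map_pow, hFx, hFy]
      ext1 <;> simp
    simp only [e, matrixUnitsHom_apply, map_sum, map_zsmul, h]
    ext1
    · simpa [Prod.fst_sum] using (Matrix.matrix_eq_sum_single M).symm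
    · simp [Prod.snd_sum]
  have hHx : H (Xmat n, cyclicGen n) = x := by
    have h : e (Xmat n) = x * e 1 := by
      rw [he1, matrixUnitsHom_apply, Finset.sum_comm, Finset.mul_sum]
      refine Finset.sum_congr rfl fun j _ => ?_
      rw [Finset.sum_eq_single ⟨(j + 1) % n, Nat.mod_lt _ hn₀⟩]
      · simp [Xmat, cyclicUnit, ← pow_eq_pow_mod _ hx, pow_succ', mul_assoc]
      · intro i _ hi
        rw [Xmat, Matrix.of_apply, if_neg (by simpa [Fin.ext_iff] using hi), zero_smul]
      · simp
    change e (Xmat n) + (1 - e 1) * cyclicLift hx (cyclicGen n) = x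
    rw [h, cyclicLift_gen, ← hcomm.eq]
    noncomm_ring
  have hHy : H (Ymat n, 0) = y := by
    change e (Ymat n) + (1 - e 1) * cyclicLift hx 0 = y
    rw [map_zero, mul_zero, add_zero, matrixUnitsHom_apply,
      Finset.sum_eq_single ⟨0, hn₀⟩, Finset.sum_eq_single ⟨0, hn₀⟩]
    · simp [Ymat, cyclicUnit, hx]
    · intro j _ hj
      simp [Ymat, show (j : ℕ) ≠ 0 by simpa [Fin.ext_iff] using hj]
    · simp
    · intro i _ hi
      simp [Ymat, show (i : ℕ) ≠ 0 by simpa [Fin.ext_iff] using hi]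
    · simp
  refine ⟨RingEquiv.ofRingHom F H ?_ ?_⟩
  · have hsnd : ((RingHom.snd _ _).comp F).comp (cyclicLift hx) = RingHom.id _ :=
      cyclicQuotient_ringHom_ext (by simp [hFx])
    refine RingHom.ext fun ⟨M, q⟩ => ?_
    change F (e M + (1 - e 1) * cyclicLift hx q) = (M, q)
    rw [map_add, map_mul, map_sub, map_one, hFe, hFe]
    ext1
    · simp
    · simpa using RingHom.congr_fun hsnd q
  · refine RingCon.Quotient.hom_ext (freeAlgebra_ringHom_ext fun i => ?_)
    fin_cases i
    · change H (F x) = x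
      rw [hFx, hHx]
    · change H (F y) = y
      rw [hFy, hHy]
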